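/- Let X be a sub-Gaussian random vector in ℝ^d with distribution μ, whose function A(h) = |h|²/2 − K(h), K(h) = log E exp(⟨h,X⟩), satisfies A(h) ≥ 0 for all h. Let X(h) be a random vector with distribution Q_h μ and let X̄(h) = X(h) − ∇K(h) be its centered version. Then for all t, h ∈ ℝ^d: E exp(⟨t, X̄(h)⟩) ≤ exp( (|t| + √(2A(h)))² / 2 ). -/

import Mathlib

open MeasureTheory ProbabilityTheory Real Filter
open scoped ENNReal RealInnerProductSpace Topology

/-- A probability distribution on `ℝ^d` is sub-Gaussian if `E exp(c|X|²) < ∞` for some `c > 0`. -/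
def IsSubGaussian {d : ℕ} (μ : Measure (EuclideanSpace ℝ (Fin d))) : Prop :=
  ∃ c > 0, Integrable (fun x => Real.exp (c * ‖x‖ ^ 2)) μ

/-- The log-Laplace transform `K(t) = log ∫ e^{⟨t,x⟩} dμ(x)`. -/
noncomputable def Kfun {d : ℕ} (μ : Measure (EuclideanSpace ℝ (Fin d)))
    (t : EuclideanSpace ℝ (Fin d)) : ℝ :=
  Real.log (∫ x, Real.exp ⟪t, x⟫ ∂μ)

/-- The function `A(t) = |t|²/2 - K(t)`. -/
noncomputable def Afun {d : ℕ} (μ : Measure (EuclideanSpace ℝ (Fin d)))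
    (t : EuclideanSpace ℝ (Fin d)) : ℝ :=
  ‖t‖ ^ 2 / 2 - Kfun μ t

/-- The Esscher transform `Q_h μ`, with density `e^{⟨h,x⟩}/L(h)` with respect to `μ`. -/
noncomputable def esscher {d : ℕ} (μ : Measure (EuclideanSpace ℝ (Fin d)))
    (h : EuclideanSpace ℝ (Fin d)) : Measure (EuclideanSpace ℝ (Fin d)) :=
  μ.withDensity fun x => ENNReal.ofReal (Real.exp ⟪h, x⟫ / ∫ y, Real.exp ⟪h, y⟫ ∂μ)

section

variable {d : ℕ} {μ : Measure (EuclideanSpace ℝ (Fin d))}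

/-- Sub-Gaussian measures have finite exponential moments of the norm. -/
lemma IsSubGaussian.integrable_exp_mul_norm (hsub : IsSubGaussian μ) (a : ℝ) :
    Integrable (fun x => Real.exp (a * ‖x‖)) μ := by
  obtain ⟨c, hc, hi⟩ := hsub
  refine (hi.const_mul (Real.exp (a ^ 2 / (4 * c)))).mono' (by fun_prop) (ae_of_all _ fun x => ?_)
  rw [Real.norm_of_nonneg (Real.exp_pos _).le, ← Real.exp_add, Real.exp_le_exp]
  have h : a ^ 2 / (4 * c) + c * ‖x‖ ^ 2 - a * ‖x‖ = (2 * c * ‖x‖ - a) ^ 2 / (4 * c) := by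
    field_simp
    ring
  have : 0 ≤ (2 * c * ‖x‖ - a) ^ 2 / (4 * c) := by positivity
  linarith

/-- The Laplace transform of a sub-Gaussian measure is finite. -/
lemma IsSubGaussian.integrable_exp_inner (hsub : IsSubGaussian μ)
    (h : EuclideanSpace ℝ (Fin d)) : Integrable (fun x => Real.exp ⟪h, x⟫) μ := by
  refine (hsub.integrable_exp_mul_norm ‖h‖).mono' (by fun_prop) (ae_of_all _ fun x => ?_)
  rw [Real.norm_of_nonneg (Real.exp_pos _).le, Real.exp_le_exp]
  exact real_inner_le_norm h x

/-- The Laplace transform of a sub-Gaussian measure may be differentiated under the integral. -/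
lemma IsSubGaussian.hasFDerivAt_laplace (hsub : IsSubGaussian μ)
    (h : EuclideanSpace ℝ (Fin d)) :
    Integrable (fun x => Real.exp ⟪h, x⟫ • innerSL ℝ x) μ ∧
    HasFDerivAt (fun t => ∫ x, Real.exp ⟪t, x⟫ ∂μ)
      (∫ x, Real.exp ⟪h, x⟫ • innerSL ℝ x ∂μ) h := by
  have hbound : ∀ x : EuclideanSpace ℝ (Fin d), ∀ t ∈ Metric.ball h 1,
      ‖Real.exp ⟪t, x⟫ • innerSL ℝ x‖ ≤ Real.exp ((‖h‖ + 2) * ‖x‖) := by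
    intro x t ht
    rw [norm_smul, innerSL_apply_norm, Real.norm_of_nonneg (Real.exp_pos _).le]
    have h1 : ‖t‖ ≤ ‖h‖ + 1 := by
      have := norm_le_norm_add_norm_sub' t h
      rw [mem_ball_iff_norm] at ht
      linarith
    have h2 : ⟪t, x⟫ ≤ (‖h‖ + 1) * ‖x‖ :=
      (real_inner_le_norm t x).trans (by gcongr)
    have h3 : ‖x‖ ≤ Real.exp ‖x‖ := by linarith [Real.add_one_le_exp ‖x‖]
    calc Real.exp ⟪t, x⟫ * ‖x‖ ≤ Real.exp ((‖h‖ + 1) * ‖x‖) * Real.exp ‖x‖ := by gcongr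
      _ = Real.exp ((‖h‖ + 2) * ‖x‖) := by rw [← Real.exp_add]; ring_nf
  have hmeas : AEStronglyMeasurable
      (fun x : EuclideanSpace ℝ (Fin d) => Real.exp ⟪h, x⟫ • innerSL ℝ x) μ :=
    Continuous.aestronglyMeasurable (by fun_prop)
  have hint := hsub.integrable_exp_mul_norm (‖h‖ + 2)
  refine ⟨hint.mono' hmeas (ae_of_all _ fun x => hbound x h (Metric.mem_ball_self one_pos)), ?_⟩
  refine hasFDerivAt_integral_of_dominated_of_fderiv_le (Metric.ball_mem_nhds h one_pos)
    (Eventually.of_forall fun t => (hsub.integrable_exp_inner t).aestronglyMeasurable)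
    (hsub.integrable_exp_inner h) hmeas (ae_of_all _ hbound) hint
    (ae_of_all _ fun x t _ => ?_)
  have h1 : HasFDerivAt (fun t : EuclideanSpace ℝ (Fin d) => ⟪t, x⟫) (innerSL ℝ x) t := by
    simpa [real_inner_comm] using (innerSL ℝ x).hasFDerivAt (x := t)
  exact h1.exp

/-- The Laplace transform of a sub-Gaussian probability measure is positive. -/
lemma IsSubGaussian.laplace_pos [NeZero μ] (hsub : IsSubGaussian μ)
    (h : EuclideanSpace ℝ (Fin d)) : 0 < ∫ x, Real.exp ⟪h, x⟫ ∂μ :=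
  integral_exp_pos (hsub.integrable_exp_inner h)

/-- The first moment of the Esscher transform in the direction `v` is `⟨v, ∇K(h)⟩`. -/
lemma IsSubGaussian.integral_exp_inner_mul_inner [NeZero μ] (hsub : IsSubGaussian μ)
    (h v : EuclideanSpace ℝ (Fin d)) :
    Integrable (fun x => Real.exp ⟪h, x⟫ * ⟪v, x⟫) μ ∧
    ∫ x, Real.exp ⟪h, x⟫ * ⟪v, x⟫ ∂μ
      = (∫ x, Real.exp ⟪h, x⟫ ∂μ) * ⟪v, gradient (Kfun μ) h⟫ := by
  obtain ⟨hi, hd⟩ := hsub.hasFDerivAt_laplace h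
  have hL := hsub.laplace_pos h
  have hK : HasFDerivAt (Kfun μ) _ h := hd.log hL.ne'
  have hfun (x : EuclideanSpace ℝ (Fin d)) :
      (Real.exp ⟪h, x⟫ • innerSL ℝ x) v = Real.exp ⟪h, x⟫ * ⟪v, x⟫ := by
    simp [real_inner_comm]
  have hiv := hi.apply_continuousLinearMap v
  have heq := ContinuousLinearMap.integral_apply hi v
  simp only [hfun] at hiv heq
  refine ⟨hiv, ?_⟩
  rw [real_inner_comm, gradient, InnerProductSpace.toDual_symm_apply, hK.fderiv, ← heq]
  simp only [smul_apply, smul_eq_mul]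
  field_simp

/-- The tangent hyperplane inequality for the convex function `K`. -/
lemma IsSubGaussian.Kfun_add_inner_gradient_le [NeZero μ] (hsub : IsSubGaussian μ)
    (h v : EuclideanSpace ℝ (Fin d)) :
    Kfun μ h + ⟪v, gradient (Kfun μ) h⟫ ≤ Kfun μ (h + v) := by
  obtain ⟨hi, heq⟩ := hsub.integral_exp_inner_mul_inner h v
  set m := ⟪v, gradient (Kfun μ) h⟫
  have hL := hsub.laplace_pos h
  have hi0 := hsub.integrable_exp_inner h
  have key : Real.exp m * ∫ x, Real.exp ⟪h, x⟫ ∂μ ≤ ∫ x, Real.exp ⟪h + v, x⟫ ∂μ := by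
    calc Real.exp m * ∫ x, Real.exp ⟪h, x⟫ ∂μ
        = ∫ x, Real.exp m * ((1 - m) * Real.exp ⟪h, x⟫ + Real.exp ⟪h, x⟫ * ⟪v, x⟫) ∂μ := by
          rw [integral_const_mul, integral_add (hi0.const_mul _) hi, integral_const_mul, heq]
          ring
      _ ≤ ∫ x, Real.exp ⟪h + v, x⟫ ∂μ := by
          refine integral_mono (((hi0.const_mul _).add hi).const_mul _)
            (hsub.integrable_exp_inner _) fun x => ?_
          have h1 : Real.exp ⟪h + v, x⟫
              = Real.exp m * (Real.exp ⟪h, x⟫ * Real.exp (⟪v, x⟫ - m)) := by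
            rw [← Real.exp_add, ← Real.exp_add, inner_add_left]
            ring_nf
          have h2 := Real.add_one_le_exp (⟪v, x⟫ - m)
          simp only [h1]
          gcongr
          calc (1 - m) * Real.exp ⟪h, x⟫ + Real.exp ⟪h, x⟫ * ⟪v, x⟫
              = Real.exp ⟪h, x⟫ * (⟪v, x⟫ - m + 1) := by ring
            _ ≤ _ := by gcongr
  have h3 := Real.log_le_log (by positivity) key
  rw [Real.log_mul (Real.exp_pos _).ne' hL.ne', Real.log_exp] at h3
  simp only [Kfun]
  linarith

/-- If `A ≥ 0`, then `|∇A(h)| ≤ √(2A(h))`, where `∇A(h) = h - ∇K(h)`. -/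
lemma IsSubGaussian.norm_sub_gradient_Kfun_le [NeZero μ] (hsub : IsSubGaussian μ)
    (hA : ∀ h, 0 ≤ Afun μ h) (h : EuclideanSpace ℝ (Fin d)) :
    ‖h - gradient (Kfun μ) h‖ ≤ Real.sqrt (2 * Afun μ h) := by
  apply Real.le_sqrt_of_sq_le
  set g := gradient (Kfun μ) h with hg
  have h1 := hsub.Kfun_add_inner_gradient_le h (g - h)
  have h2 := hA g
  rw [← hg, add_sub_cancel, inner_sub_left, real_inner_self_eq_norm_sq] at h1
  rw [norm_sub_sq_real]
  simp only [Afun] at h2 ⊢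
  linarith

/-- The Laplace transform of the centered Esscher transform. -/
lemma IsSubGaussian.integral_exp_inner_sub_esscher [NeZero μ] (hsub : IsSubGaussian μ)
    (t h g : EuclideanSpace ℝ (Fin d)) :
    ∫ x, Real.exp ⟪t, x - g⟫ ∂(esscher μ h)
      = Real.exp (Kfun μ (h + t) - Kfun μ h - ⟪t, g⟫) := by
  have hL := hsub.laplace_pos h
  rw [esscher, integral_withDensity_eq_integral_toReal_smul (by fun_prop)
    (ae_of_all _ fun _ => ENNReal.ofReal_lt_top)]
  have hfun (x : EuclideanSpace ℝ (Fin d)) :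
      (ENNReal.ofReal (Real.exp ⟪h, x⟫ / ∫ y, Real.exp ⟪h, y⟫ ∂μ)).toReal •
        Real.exp ⟪t, x - g⟫
      = Real.exp (-⟪t, g⟫) / (∫ y, Real.exp ⟪h, y⟫ ∂μ) * Real.exp ⟪h + t, x⟫ := by
    rw [ENNReal.toReal_ofReal (by positivity), smul_eq_mul, inner_sub_right, inner_add_left,
      sub_eq_add_neg, Real.exp_add, Real.exp_add]
    ring
  simp only [hfun]
  rw [integral_const_mul, Real.exp_sub, Real.exp_sub, Kfun, Kfun, Real.exp_log hL,
    Real.exp_log (hsub.laplace_pos _), Real.exp_neg]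
  field_simp

end

theorem stmt9 {d : ℕ} (hd : 1 ≤ d)
    (μ : Measure (EuclideanSpace ℝ (Fin d))) [IsProbabilityMeasure μ]
    (hsub : IsSubGaussian μ)
    (hA : ∀ h, 0 ≤ Afun μ h)
    (t h : EuclideanSpace ℝ (Fin d)) :
    (∫ x, Real.exp ⟪t, x - gradient (Kfun μ) h⟫ ∂(esscher μ h))
      ≤ Real.exp ((‖t‖ + Real.sqrt (2 * Afun μ h)) ^ 2 / 2) := by
  rw [hsub.integral_exp_inner_sub_esscher, Real.exp_le_exp]
  have h1 := hsub.norm_sub_gradient_Kfun_le hA h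
  have h2 : ⟪t, h - gradient (Kfun μ) h⟫ ≤ ‖t‖ * Real.sqrt (2 * Afun μ h) :=
    (real_inner_le_norm _ _).trans (by gcongr)
  have h3 := hA (h + t)
  have h4 := Real.sq_sqrt (mul_nonneg zero_le_two (hA h))
  rw [inner_sub_right, real_inner_comm] at h2
  rw [add_sq, h4]
  simp only [Afun, norm_add_sq_real] at h2 h3 ⊢
  linarith
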